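/- Let G be a group admitting a normal subgroup N such that N is isomorphic to the infinite cyclic group ℤ and the quotient group G/N is isomorphic to ℤ. Then G contains a subgroup of index at most 2 that is isomorphic to ℤ × ℤ. In particular, every extension of ℤ by ℤ is virtually abelian. -/

import Mathlib

/-- The homomorphism `(m, n) ↦ a ^ m * s ^ n` determined by two commuting elements. -/
def Commute.zpowProdHom {G : Type*} [Group G] {a s : G} (h : Commute a s) :
    Multiplicative (ℤ × ℤ) →* G where
  toFun x := a ^ x.toAdd.1 * s ^ x.toAdd.2
  map_one' := by simp
  map_mul' x y := by
    simp only [toAdd_mul, Prod.fst_add, Prod.snd_add, zpow_add]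
    have := (h.zpow_zpow y.toAdd.1 x.toAdd.2).eq
    simp only [mul_assoc]
    rw [← mul_assoc (a ^ y.toAdd.1), this, mul_assoc]

/-- If `a` generates an infinite cyclic kernel of `φ : G →* ℤ` and `s` commutes with `a` and has
image `k ≠ 0`, then `⟨a, s⟩` is isomorphic to `ℤ × ℤ` and has index `|k|`. -/
theorem exists_subgroup_index_eq_natAbs_mulEquiv_int_prod_int {G : Type*} [Group G]
    (φ : G →* Multiplicative ℤ) (hφ : Function.Surjective φ) {a s : G}
    (ha : Subgroup.zpowers a = φ.ker) (ha' : Function.Injective fun n : ℤ ↦ a ^ n)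
    (h : Commute a s) {k : ℤ} (hk : k ≠ 0) (hs : φ s = Multiplicative.ofAdd k) :
    ∃ H : Subgroup G, H.index = k.natAbs ∧ Nonempty (H ≃* Multiplicative (ℤ × ℤ)) := by
  have hφa : φ a = 1 := by
    rw [← MonoidHom.mem_ker, ← ha]
    exact Subgroup.mem_zpowers a
  have hinj : Function.Injective h.zpowProdHom := by
    rw [injective_iff_map_eq_one]
    intro x hx
    change a ^ x.toAdd.1 * s ^ x.toAdd.2 = 1 at hx
    have h2 : x.toAdd.2 = 0 := by
      have := congrArg (fun g ↦ (φ g).toAdd) hx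
      simpa [hφa, hs, hk] using this
    have h1 : x.toAdd.1 = 0 := ha' (by simpa [h2] using hx)
    exact Multiplicative.toAdd.injective (Prod.ext h1 h2)
  have hrange : h.zpowProdHom.range =
      (AddSubgroup.toSubgroup (AddSubgroup.zmultiples k)).comap φ := by
    ext g
    constructor
    · rintro ⟨x, rfl⟩
      change (φ (a ^ x.toAdd.1 * s ^ x.toAdd.2)).toAdd ∈ AddSubgroup.zmultiples k
      exact ⟨x.toAdd.2, by simp [hφa, hs]⟩
    · rintro ⟨n, hn⟩
      have hn : n * k = (φ g).toAdd := by simpa using hn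
      have hmem : g * (s ^ n)⁻¹ ∈ Subgroup.zpowers a := by
        rw [ha, MonoidHom.mem_ker]
        apply Multiplicative.toAdd.injective
        simp [hs, hn]
      obtain ⟨m, hm⟩ := hmem
      refine ⟨Multiplicative.ofAdd (m, n), ?_⟩
      change a ^ m * s ^ n = g
      simp only at hm
      rw [hm, inv_mul_cancel_right]
  refine ⟨h.zpowProdHom.range, ?_, ⟨(MonoidHom.ofInjective hinj).symm⟩⟩
  rw [hrange, Subgroup.index_comap_of_surjective _ hφ, AddSubgroup.index_toSubgroup,
    Int.index_zmultiples]

/-- An element normalizing an infinite cyclic subgroup centralizes or inverts its generator. -/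
theorem conj_eq_or_eq_inv_of_normal_zpowers {G : Type*} [Group G] {a : G}
    (hn : (Subgroup.zpowers a).Normal) (ha : Function.Injective fun n : ℤ ↦ a ^ n) (t : G) :
    t * a * t⁻¹ = a ∨ t * a * t⁻¹ = a⁻¹ := by
  obtain ⟨m, hm⟩ := hn.conj_mem a (Subgroup.mem_zpowers a) t
  obtain ⟨n, hn⟩ := hn.conj_mem a (Subgroup.mem_zpowers a) t⁻¹
  simp only at hm hn
  have hmn : m * n = 1 := by
    apply ha
    simp only [zpow_mul, zpow_one]
    rw [hm, conj_zpow, hn]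
    group
  rcases Int.eq_one_or_neg_one_of_mul_eq_one hmn with rfl | rfl
  · left; simpa using hm.symm
  · right; simpa using hm.symm

/-- An extension of `ℤ` by `ℤ` has a subgroup of index exactly `1` or `2` isomorphic to
`ℤ × ℤ`. -/
theorem exists_index_eq_one_or_two_mulEquiv_int_prod_int {G : Type*} [Group G]
    (N : Subgroup G) [N.Normal]
    (hN : Nonempty (N ≃* Multiplicative ℤ))
    (hQ : Nonempty ((G ⧸ N) ≃* Multiplicative ℤ)) :
    ∃ H : Subgroup G, (H.index = 1 ∨ H.index = 2) ∧
      Nonempty (H ≃* Multiplicative (ℤ × ℤ)) := by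
  obtain ⟨e⟩ := hN
  obtain ⟨q⟩ := hQ
  let φ : G →* Multiplicative ℤ := q.toMonoidHom.comp (QuotientGroup.mk' N)
  have hφ : Function.Surjective φ := q.surjective.comp (QuotientGroup.mk'_surjective N)
  have hker : φ.ker = N := by
    ext g
    simp [φ]
  let a : G := e.symm (Multiplicative.ofAdd 1)
  have hpow (n : ℤ) : a ^ n = e.symm (Multiplicative.ofAdd n) := by
    have : Multiplicative.ofAdd n = Multiplicative.ofAdd (1 : ℤ) ^ n := by
      rw [← ofAdd_zsmul]; simp
    rw [this, map_zpow, Subgroup.coe_zpow]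
  have ha' : Function.Injective fun n : ℤ ↦ a ^ n := by
    intro m n hmn
    simp only [hpow] at hmn
    exact Multiplicative.ofAdd.injective (e.symm.injective (Subtype.ext hmn))
  have haN : Subgroup.zpowers a = N := by
    refine le_antisymm (Subgroup.zpowers_le.2 (SetLike.coe_mem _)) fun g hg ↦ ?_
    exact ⟨(e ⟨g, hg⟩).toAdd, by simp [hpow]⟩
  have ha : Subgroup.zpowers a = φ.ker := haN.trans hker.symm
  obtain ⟨t, ht⟩ := hφ (Multiplicative.ofAdd 1)
  rcases conj_eq_or_eq_inv_of_normal_zpowers (haN ▸ ‹N.Normal›) ha' t with hc | hc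
  · have hcomm : Commute a t := (mul_inv_eq_iff_eq_mul.1 hc).symm
    obtain ⟨H, hi, hH⟩ := exists_subgroup_index_eq_natAbs_mulEquiv_int_prod_int φ hφ ha ha'
      hcomm one_ne_zero ht
    exact ⟨H, .inl hi, hH⟩
  · have hcomm : Commute a (t ^ 2) := by
      have : t ^ 2 * a * (t ^ 2)⁻¹ = a := by
        calc t ^ 2 * a * (t ^ 2)⁻¹ = t * (t * a * t⁻¹) * t⁻¹ := by simp only [pow_two, mul_inv_rev, mul_assoc]
          _ = (t * a * t⁻¹)⁻¹ := by rw [conj_inv, hc]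
          _ = a := by rw [hc, inv_inv]
      exact (mul_inv_eq_iff_eq_mul.1 this).symm
    obtain ⟨H, hi, hH⟩ := exists_subgroup_index_eq_natAbs_mulEquiv_int_prod_int φ hφ ha ha'
      hcomm two_ne_zero (by rw [map_pow, ht, ← ofAdd_nsmul]; rfl)
    exact ⟨H, .inr hi, hH⟩

/-- If a group `G` has a normal subgroup `N` isomorphic to the infinite cyclic group `ℤ`
with quotient `G/N` isomorphic to `ℤ`, then `G` has a subgroup of index at most `2` that is
isomorphic to `ℤ × ℤ`; in particular every extension of `ℤ` by `ℤ` is virtually abelian. -/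
theorem extension_int_by_int_virtually_abelian {G : Type*} [Group G]
    (N : Subgroup G) [N.Normal]
    (hN : Nonempty (N ≃* Multiplicative ℤ))
    (hQ : Nonempty ((G ⧸ N) ≃* Multiplicative ℤ)) :
    ∃ H : Subgroup G, H.index ≤ 2 ∧ Nonempty (H ≃* Multiplicative (ℤ × ℤ)) := by
  obtain ⟨H, hi, hH⟩ := exists_index_eq_one_or_two_mulEquiv_int_prod_int N hN hQ
  exact ⟨H, by omega, hH⟩
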